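/- arXiv:0809.1214 — 3 statements merged into one kernel-verified Lean document; each statement's English description precedes it below -/
import Mathlib

section
/- Let X be a topological space, K ⊆ X × X a closed transitive relation containing the diagonal Δ = {(x,x) : x ∈ X}, and C ⊆ X × X a compact relation. For each integer i ≥ 0 let K ∘ (C ∘ K)^i be the set of pairs (x,z) for which there exists a chain x = w₀, w₁, …, w_{2i+1} = z with (w_{2j}, w_{2j+1}) ∈ K for 0 ≤ j ≤ i and (w_{2j+1}, w_{2j+2}) ∈ C for 0 ≤ j ≤ i−1. Suppose there exists an integer N ≥ 0 such that ⋃_{i=0}^{∞} K ∘ (C ∘ K)^i = ⋃_{i=0}^{N} K ∘ (C ∘ K)^i. Then this finite union equals the smallest closed transitive relation containing K ∪ C. -/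
/-- A relation (a subset of `X × X`) is transitive. -/
def TransRel {X : Type*} (S : Set (X × X)) : Prop :=
  ∀ x y z : X, (x, y) ∈ S → (y, z) ∈ S → (x, z) ∈ S

/-- `KRel R` is the smallest closed transitive relation containing `R`, i.e. the
intersection of all closed transitive relations containing `R`. -/
def KRel {X : Type*} [TopologicalSpace X] (R : Set (X × X)) : Set (X × X) :=
  ⋂₀ {S : Set (X × X) | IsClosed S ∧ TransRel S ∧ R ⊆ S}

/-- The relation `K ∘ (C ∘ K)^i`: pairs `(x,z)` joined by a chain
`x = w₀, w₁, …, w_{2i+1} = z` with `(w_{2j}, w_{2j+1}) ∈ K` for `0 ≤ j ≤ i`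
and `(w_{2j+1}, w_{2j+2}) ∈ C` for `0 ≤ j ≤ i-1`. -/
def KCKpow {X : Type*} (K C : Set (X × X)) (i : ℕ) : Set (X × X) :=
  {p : X × X | ∃ w : ℕ → X, w 0 = p.1 ∧ w (2 * i + 1) = p.2 ∧
    (∀ j : ℕ, j ≤ i → (w (2 * j), w (2 * j + 1)) ∈ K) ∧
    (∀ j : ℕ, j < i → (w (2 * j + 1), w (2 * j + 2)) ∈ C)}

theorem KCK_zero {X : Type*} (K C : Set (X × X)) : KCKpow K C 0 = K := by
  ext ⟨x, z⟩
  constructor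
  · rintro ⟨w, h0, h1, hK, -⟩
    have := hK 0 le_rfl
    simp only [Nat.mul_zero, Nat.zero_add] at *
    rwa [h0, h1] at this
  · intro h
    refine ⟨fun n => if n = 0 then x else z, by simp, by simp, ?_, ?_⟩
    · intro j hj
      obtain rfl : j = 0 := by omega
      simpa using h
    · intro j hj
      omega

theorem KCK_succ {X : Type*} (K C : Set (X × X)) (i : ℕ) :
    KCKpow K C (i + 1) =
      {p | ∃ c ∈ C, (p.1, c.1) ∈ KCKpow K C i ∧ (c.2, p.2) ∈ K} := by
  ext ⟨x, z⟩
  constructor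
  · rintro ⟨w, h0, h1, hK, hC⟩
    refine ⟨(w (2 * i + 1), w (2 * i + 2)), hC i (by omega),
      ⟨w, h0, rfl, fun j hj => hK j (by omega), fun j hj => hC j (by omega)⟩, ?_⟩
    have := hK (i + 1) le_rfl
    rw [h1] at this
    exact this
  · rintro ⟨⟨a, b⟩, hc, ⟨w, h0, h1, hK, hC⟩, hz⟩
    simp only at h0 h1 hz
    refine ⟨fun n => if n ≤ 2 * i + 1 then w n else if n = 2 * i + 2 then b else z,
      by simpa using h0, ?_, ?_, ?_⟩
    · simp only
      rw [if_neg (by omega), if_neg (by omega)]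
    · intro j hj
      simp only
      by_cases h : j ≤ i
      · rw [if_pos (by omega), if_pos (by omega)]
        exact hK j h
      · rw [if_neg (by omega), if_pos (by omega), if_neg (by omega), if_neg (by omega)]
        exact hz
    · intro j hj
      simp only
      by_cases h : j < i
      · rw [if_pos (by omega), if_pos (by omega)]
        exact hC j h
      · obtain rfl : j = i := by omega
        rw [if_pos (by omega), if_neg (by omega), if_pos rfl, h1]
        exact hc

theorem closed_comp {X : Type*} [TopologicalSpace X] {A B C : Set (X × X)}
    (hA : IsClosed A) (hB : IsClosed B) (hC : IsCompact C) :
    IsClosed {p : X × X | ∃ c ∈ C, (p.1, c.1) ∈ A ∧ (c.2, p.2) ∈ B} := by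
  haveI : CompactSpace C := isCompact_iff_compactSpace.mp hC
  have h1 : IsClosed {q : (X × X) × C | (q.1.1, q.2.1.1) ∈ A ∧ (q.2.1.2, q.1.2) ∈ B} :=
    (hA.preimage (f := fun q : (X × X) × C => (q.1.1, q.2.1.1)) (by fun_prop)).inter
      (hB.preimage (f := fun q : (X × X) × C => (q.2.1.2, q.1.2)) (by fun_prop))
  have h2 := isClosedMap_fst_of_compactSpace _ h1
  convert h2 using 1
  ext p
  constructor
  · rintro ⟨c, hc, h⟩
    exact ⟨(p, ⟨c, hc⟩), h, rfl⟩
  · rintro ⟨⟨q, c⟩, h, rfl⟩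
    exact ⟨c.1, c.2, h⟩

/-- Let `K` be a closed transitive relation containing the
diagonal and `C` a compact relation. If the union `⋃_{i≥0} K ∘ (C ∘ K)^i`
stabilizes at a finite stage `N`, then the finite union equals the smallest
closed transitive relation containing `K ∪ C`. -/
theorem finite_union_KCKpow_eq_KRel_union
    {X : Type*} [TopologicalSpace X] (K C : Set (X × X))
    (hKclosed : IsClosed K) (hKtrans : TransRel K)
    (hKdiag : ∀ x : X, (x, x) ∈ K) (hC : IsCompact C)
    (N : ℕ) (hN : (⋃ i : ℕ, KCKpow K C i) = ⋃ i ≤ N, KCKpow K C i) :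
    (⋃ i ≤ N, KCKpow K C i) = KRel (K ∪ C) := by
  have hcl : ∀ i, IsClosed (KCKpow K C i) := by
    intro i
    induction i with
    | zero => rwa [KCK_zero]
    | succ i ih =>
      rw [KCK_succ]
      exact closed_comp ih hKclosed hC
  have htr : ∀ i j x y z, (x, y) ∈ KCKpow K C i → (y, z) ∈ KCKpow K C j →
      (x, z) ∈ KCKpow K C (i + j) := by
    intro i j
    induction j with
    | zero =>
      intro x y z hxy hyz
      rw [KCK_zero] at hyz
      rw [Nat.add_zero]
      cases i with
      | zero =>
        rw [KCK_zero] at hxy ⊢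
        exact hKtrans _ _ _ hxy hyz
      | succ i =>
        rw [KCK_succ] at hxy ⊢
        obtain ⟨c, hc, h1, h2⟩ := hxy
        exact ⟨c, hc, h1, hKtrans _ _ _ h2 hyz⟩
    | succ j ih =>
      intro x y z hxy hyz
      rw [← Nat.add_assoc]
      rw [KCK_succ] at hyz ⊢
      obtain ⟨c, hc, h1, h2⟩ := hyz
      exact ⟨c, hc, ih _ _ _ hxy h1, h2⟩
  apply Set.Subset.antisymm
  · rintro p hp S ⟨-, hS, hR⟩
    have hsub : ∀ i, KCKpow K C i ⊆ S := by
      intro i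
      induction i with
      | zero =>
        rw [KCK_zero]
        exact fun q hq => hR (Or.inl hq)
      | succ i ih =>
        rw [KCK_succ]
        rintro ⟨x, z⟩ ⟨⟨a, b⟩, hc, h1, h2⟩
        exact hS _ _ _ (hS _ _ _ (ih h1) (hR (Or.inr hc))) (hR (Or.inl h2))
    simp only [Set.mem_iUnion] at hp
    obtain ⟨i, -, hi⟩ := hp
    exact hsub i hi
  · apply Set.sInter_subset_of_mem
    refine ⟨(Set.finite_le_nat N).isClosed_biUnion (fun i _ => hcl i), ?_, ?_⟩
    · rw [← hN]
      intro x y z hxy hyz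
      obtain ⟨i, hi⟩ := Set.mem_iUnion.mp hxy
      obtain ⟨j, hj⟩ := Set.mem_iUnion.mp hyz
      exact Set.mem_iUnion.mpr ⟨i + j, htr i j x y z hi hj⟩
    · rw [← hN]
      rintro ⟨x, z⟩ (h | h)
      · exact Set.mem_iUnion.mpr ⟨0, by rwa [KCK_zero]⟩
      · refine Set.mem_iUnion.mpr ⟨1, ?_⟩
        rw [show (1 : ℕ) = 0 + 1 from rfl, KCK_succ]
        refine ⟨(x, z), h, ?_, hKdiag z⟩
        rw [KCK_zero]
        exact hKdiag x
end

section
/- Let X be a topological space, K ⊆ X × X a closed transitive relation, and (y_n)_{n∈ℕ} a sequence in X with (y_n, y_{n+1}) ∈ K for every n. If p and q are both cluster points of the sequence (y_n), then (p,q) ∈ K and (q,p) ∈ K. -/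
open Filter

/-- Let `K` be a closed transitive relation and `(y_n)` a sequence
with `(y_n, y_{n+1}) ∈ K` for every `n`. If `p` and `q` are both cluster points of
the sequence `(y_n)`, then `(p,q) ∈ K` and `(q,p) ∈ K`. -/
theorem mem_of_clusterPts_of_chain
    {X : Type*} [TopologicalSpace X] (K : Set (X × X))
    (hKclosed : IsClosed K) (hKtrans : TransRel K)
    (y : ℕ → X) (hchain : ∀ n : ℕ, (y n, y (n + 1)) ∈ K)
    (p q : X) (hp : MapClusterPt p atTop y) (hq : MapClusterPt q atTop y) :
    (p, q) ∈ K ∧ (q, p) ∈ K := by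
  have hlt : ∀ m k : ℕ, (y m, y (m + k + 1)) ∈ K := by
    intro m k
    induction k with
    | zero => exact hchain m
    | succ k ih => exact hKtrans _ _ _ ih (hchain (m + k + 1))
  have key : ∀ a b : X, MapClusterPt a atTop y → MapClusterPt b atTop y → (a, b) ∈ K := by
    intro a b ha hb
    rw [← hKclosed.closure_eq, mem_closure_iff_nhds]
    intro t ht
    obtain ⟨u, hu, v, hv, huv⟩ := mem_nhds_prod_iff.1 ht
    obtain ⟨m, hm⟩ := (mapClusterPt_iff_frequently.1 ha u hu).exists
    obtain ⟨n, hn, hnv⟩ := (frequently_atTop.1 (mapClusterPt_iff_frequently.1 hb v hv)) (m + 1)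
    obtain ⟨k, rfl⟩ := Nat.exists_eq_add_of_le hn
    refine ⟨(y m, y (m + 1 + k)), huv ⟨hm, hnv⟩, ?_⟩
    have h := hlt m k
    rwa [Nat.add_right_comm] at h
  exact ⟨key p q hp hq, key q p hq hp⟩
end

section
/- Let X be a topological space, K ⊆ X × X a closed transitive relation, and (y_n)_{n∈ℕ} a sequence in X with (y_n, y_{n+1}) ∈ K for every n. Let A, D ⊆ X be compact sets with A ∩ D = ∅, and suppose y_n ∈ A for infinitely many n and y_n ∈ D for infinitely many n. Then there exist points p ∈ A and q ∈ D with (p,q) ∈ K and (q,p) ∈ K; in particular p ≠ q, so K is not antisymmetric. -/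
open Filter

/-- A relation (a subset of `X × X`) is antisymmetric. -/
def AntisymRel' {X : Type*} (S : Set (X × X)) : Prop :=
  ∀ x y : X, (x, y) ∈ S → (y, x) ∈ S → x = y

/-- Let `K` be a closed transitive relation and `(y_n)` a sequence
with `(y_n, y_{n+1}) ∈ K` for every `n`. If `A` and `D` are disjoint compact sets
each containing `y_n` for infinitely many `n`, then there are `p ∈ A` and `q ∈ D`
with `(p,q) ∈ K`, `(q,p) ∈ K` and `p ≠ q`; in particular `K` is not antisymmetric. -/
theorem exists_pair_of_chain_in_disjoint_compacts
    {X : Type*} [TopologicalSpace X] (K : Set (X × X))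
    (hKclosed : IsClosed K) (hKtrans : TransRel K)
    (y : ℕ → X) (hchain : ∀ n : ℕ, (y n, y (n + 1)) ∈ K)
    (A D : Set X) (hA : IsCompact A) (hD : IsCompact D) (hAD : Disjoint A D)
    (hyA : ∃ᶠ n in atTop, y n ∈ A) (hyD : ∃ᶠ n in atTop, y n ∈ D) :
    (∃ p ∈ A, ∃ q ∈ D, (p, q) ∈ K ∧ (q, p) ∈ K ∧ p ≠ q) ∧
      ¬ AntisymRel' K := by
  have hlt : ∀ m k : ℕ, (y m, y (m + k + 1)) ∈ K := by
    intro m k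
    induction k with
    | zero => exact hchain m
    | succ k ih => exact hKtrans _ _ _ ih (hchain _)
  have key : ∀ p q : X, MapClusterPt p atTop y → MapClusterPt q atTop y → (p, q) ∈ K := by
    intro p q hp hq
    rw [← hKclosed.closure_eq, mem_closure_iff_nhds]
    intro t ht
    obtain ⟨U, hU, V, hV, hUV⟩ := mem_nhds_prod_iff.1 ht
    obtain ⟨m, hm⟩ := (mapClusterPt_iff_frequently.1 hp U hU).exists
    obtain ⟨n, hn, hnV⟩ := frequently_atTop.1 (mapClusterPt_iff_frequently.1 hq V hV) (m + 1)
    obtain ⟨k, rfl⟩ : ∃ k, n = m + k + 1 := ⟨n - (m + 1), by omega⟩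
    exact ⟨_, hUV ⟨hm, hnV⟩, hlt m k⟩
  obtain ⟨p, hpA, hp⟩ := hA.exists_mapClusterPt_of_frequently hyA
  obtain ⟨q, hqD, hq⟩ := hD.exists_mapClusterPt_of_frequently hyD
  have hne : p ≠ q := fun h => Set.disjoint_left.1 hAD hpA (h ▸ hqD)
  exact ⟨⟨p, hpA, q, hqD, key p q hp hq, key q p hq hp, hne⟩,
    fun h => hne (h p q (key p q hp hq) (key q p hq hp))⟩
end
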